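/- Let Λ be a finite-dimensional algebra over a field K and let T be a torsion class in mod Λ. Then T is widely generated if and only if T = T(MCE(T^⊥)), the smallest torsion class containing the minimal co-extending modules of the torsion-free class T^⊥. -/

import Mathlib

open Function DirectSum

namespace BrickPaper

variable (Λ : Type) [Ring Λ]

/-- `M` belongs to `mod Λ`, i.e. is a finitely generated module. -/
abbrev FG (M : ModuleCat.{0} Λ) : Prop := Module.Finite Λ M

/-- A class of modules closed under isomorphism. -/
def IsoClosed (C : Set (ModuleCat.{0} Λ)) : Prop :=
  ∀ ⦃M N : ModuleCat.{0} Λ⦄, Nonempty (M ≃ₗ[Λ] N) → M ∈ C → N ∈ C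

/-- A class of modules containing the zero modules. -/
def HasZeroObj (C : Set (ModuleCat.{0} Λ)) : Prop :=
  ∀ M : ModuleCat.{0} Λ, Subsingleton M → M ∈ C

/-- Closure under extensions: if `0 → A → M → B → 0` is exact with `A, B ∈ C` then `M ∈ C`. -/
def ExtClosed (C : Set (ModuleCat.{0} Λ)) : Prop :=
  ∀ ⦃A M B : ModuleCat.{0} Λ⦄ (f : A →ₗ[Λ] M) (g : M →ₗ[Λ] B),
    Function.Injective f → Function.Surjective g →
    LinearMap.range f = LinearMap.ker g → A ∈ C → B ∈ C → M ∈ C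

/-- Closure under quotients (images of surjections). -/
def QuotClosed (C : Set (ModuleCat.{0} Λ)) : Prop :=
  ∀ ⦃M N : ModuleCat.{0} Λ⦄ (g : M →ₗ[Λ] N), Function.Surjective g → M ∈ C → N ∈ C

/-- Closure under submodules (sources of injections). -/
def SubClosed (C : Set (ModuleCat.{0} Λ)) : Prop :=
  ∀ ⦃M N : ModuleCat.{0} Λ⦄ (f : M →ₗ[Λ] N), Function.Injective f → N ∈ C → M ∈ C

/-- Closure under kernels of morphisms between members. -/
def KerClosed (C : Set (ModuleCat.{0} Λ)) : Prop :=
  ∀ ⦃M N : ModuleCat.{0} Λ⦄ (f : M →ₗ[Λ] N), M ∈ C → N ∈ C →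
    ModuleCat.of Λ ↥(LinearMap.ker f) ∈ C

/-- Closure under cokernels of morphisms between members. -/
def CokerClosed (C : Set (ModuleCat.{0} Λ)) : Prop :=
  ∀ ⦃M N : ModuleCat.{0} Λ⦄ (f : M →ₗ[Λ] N), M ∈ C → N ∈ C →
    ModuleCat.of Λ ((N : Type) ⧸ LinearMap.range f) ∈ C

/-- A wide subcategory of `mod Λ`: a class of finitely generated modules, closed under
isomorphisms, containing `0`, and closed under kernels, cokernels and extensions. -/
def IsWide (C : Set (ModuleCat.{0} Λ)) : Prop :=
  (∀ M ∈ C, FG Λ M) ∧ IsoClosed Λ C ∧ HasZeroObj Λ C ∧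
    KerClosed Λ C ∧ CokerClosed Λ C ∧ ExtClosed Λ C

/-- A wide subcategory of the big module category `Mod Λ` (no finiteness condition). -/
def IsWideBig (C : Set (ModuleCat.{0} Λ)) : Prop :=
  IsoClosed Λ C ∧ HasZeroObj Λ C ∧ KerClosed Λ C ∧ CokerClosed Λ C ∧ ExtClosed Λ C

/-- A torsion class in `mod Λ`: closed under quotients and extensions. -/
def IsTorsionClass (C : Set (ModuleCat.{0} Λ)) : Prop :=
  (∀ M ∈ C, FG Λ M) ∧ IsoClosed Λ C ∧ HasZeroObj Λ C ∧ QuotClosed Λ C ∧ ExtClosed Λ C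

/-- A torsion-free class in `mod Λ`: closed under submodules and extensions. -/
def IsTorsionFreeClass (C : Set (ModuleCat.{0} Λ)) : Prop :=
  (∀ M ∈ C, FG Λ M) ∧ IsoClosed Λ C ∧ HasZeroObj Λ C ∧ SubClosed Λ C ∧ ExtClosed Λ C

/-- The smallest torsion class containing `X`. -/
def torsClosure (X : Set (ModuleCat.{0} Λ)) : Set (ModuleCat.{0} Λ) :=
  ⋂₀ {C | IsTorsionClass Λ C ∧ X ⊆ C}

/-- The smallest torsion-free class containing `X`. -/
def torfClosure (X : Set (ModuleCat.{0} Λ)) : Set (ModuleCat.{0} Λ) :=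
  ⋂₀ {C | IsTorsionFreeClass Λ C ∧ X ⊆ C}

/-- A widely generated torsion class. -/
def IsWidelyGenTors (T : Set (ModuleCat.{0} Λ)) : Prop :=
  IsTorsionClass Λ T ∧ ∃ W, IsWide Λ W ∧ T = torsClosure Λ W

/-- A widely generated torsion-free class. -/
def IsWidelyGenTorf (F : Set (ModuleCat.{0} Λ)) : Prop :=
  IsTorsionFreeClass Λ F ∧ ∃ W, IsWide Λ W ∧ F = torfClosure Λ W

/-- A finitely generated torsion class: generated by a single module of `mod Λ`. -/
def IsFinGenTors (T : Set (ModuleCat.{0} Λ)) : Prop :=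
  IsTorsionClass Λ T ∧ ∃ M : ModuleCat.{0} Λ, FG Λ M ∧ T = torsClosure Λ {M}

/-- `T' ` covers `T` in the poset of torsion classes. -/
def TorsCovers (T' T : Set (ModuleCat.{0} Λ)) : Prop :=
  IsTorsionClass Λ T' ∧ T ⊂ T' ∧
    ∀ T'', IsTorsionClass Λ T'' → T ⊂ T'' → T'' ⊆ T' → T'' = T'

/-- `F'` covers `F` in the poset of torsion-free classes. -/
def TorfCovers (F' F : Set (ModuleCat.{0} Λ)) : Prop :=
  IsTorsionFreeClass Λ F' ∧ F ⊂ F' ∧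
    ∀ F'', IsTorsionFreeClass Λ F'' → F ⊂ F'' → F'' ⊆ F' → F'' = F'

/-- A brick: a finitely generated module whose endomorphism ring is a division ring. -/
def IsBrick (M : ModuleCat.{0} Λ) : Prop :=
  FG Λ M ∧ Nontrivial M ∧ ∀ f : M →ₗ[Λ] M, f ≠ 0 → Function.Bijective f

/-- A semibrick, regarded as an isomorphism-closed class of bricks (i.e. a set of
isomorphism classes of bricks) which are pairwise Hom-orthogonal. -/
def IsSemibrick (S : Set (ModuleCat.{0} Λ)) : Prop :=
  (∀ M ∈ S, IsBrick Λ M) ∧ IsoClosed Λ S ∧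
    ∀ M ∈ S, ∀ N ∈ S, IsEmpty (M ≃ₗ[Λ] N) → ∀ f : M →ₗ[Λ] N, f = 0

/-- A monobrick, regarded as an isomorphism-closed class of bricks (i.e. a set of
isomorphism classes of bricks) such that every morphism between members is zero or injective. -/
def IsMonobrick (S : Set (ModuleCat.{0} Λ)) : Prop :=
  (∀ M ∈ S, IsBrick Λ M) ∧ IsoClosed Λ S ∧
    ∀ M ∈ S, ∀ N ∈ S, ∀ f : M →ₗ[Λ] N, f = 0 ∨ Function.Injective f

/-- `N` is a cofinal extension of the monobrick `M`. -/
def IsCofinalExtension (M N : Set (ModuleCat.{0} Λ)) : Prop :=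
  IsMonobrick Λ N ∧ M ⊆ N ∧
    ∀ X ∈ N, ∃ Y ∈ M, ∃ f : X →ₗ[Λ] Y, Function.Injective f

/-- A cofinally closed monobrick: a monobrick with no proper cofinal extension. -/
def IsCofinallyClosed (M : Set (ModuleCat.{0} Λ)) : Prop :=
  IsMonobrick Λ M ∧ ∀ N, IsCofinalExtension Λ M N → N = M

/-- `S` contains only finitely many modules up to isomorphism. -/
def FiniteUpToIso (S : Set (ModuleCat.{0} Λ)) : Prop :=
  ∃ B : Set (ModuleCat.{0} Λ), B.Finite ∧ ∀ M ∈ S, ∃ N ∈ B, Nonempty (M ≃ₗ[Λ] N)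

/-- `Λ` is brick-finite: there are only finitely many bricks up to isomorphism. -/
def BrickFinite : Prop := FiniteUpToIso Λ {M | IsBrick Λ M}

/-- Right Hom-perpendicular class `T^⊥` inside `mod Λ`. -/
def rPerp (T : Set (ModuleCat.{0} Λ)) : Set (ModuleCat.{0} Λ) :=
  {M | FG Λ M ∧ ∀ X ∈ T, ∀ f : X →ₗ[Λ] M, f = 0}

/-- Left Hom-perpendicular class `^⊥F` inside `mod Λ`. -/
def lPerp (F : Set (ModuleCat.{0} Λ)) : Set (ModuleCat.{0} Λ) :=
  {M | FG Λ M ∧ ∀ Y ∈ F, ∀ f : M →ₗ[Λ] Y, f = 0}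

/-- A minimal extending module for a torsion class `T`. -/
def IsMinExt (T : Set (ModuleCat.{0} Λ)) (M : ModuleCat.{0} Λ) : Prop :=
  FG Λ M ∧ Nontrivial M ∧
    (∀ S : Submodule Λ M, S ≠ ⊥ → ModuleCat.of Λ ((M : Type) ⧸ S) ∈ T) ∧
    (∀ (X T' : ModuleCat.{0} Λ) (f : M →ₗ[Λ] X) (g : X →ₗ[Λ] T'),
      Function.Injective f → Function.Surjective g →
      LinearMap.range f = LinearMap.ker g → T' ∈ T →
      (¬ ∃ r : X →ₗ[Λ] M, r ∘ₗ f = LinearMap.id) → X ∈ T) ∧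
    (∀ X ∈ T, ∀ f : X →ₗ[Λ] M, f = 0)

/-- A minimal co-extending module for a torsion-free class `F`. -/
def IsMinCoext (F : Set (ModuleCat.{0} Λ)) (M : ModuleCat.{0} Λ) : Prop :=
  FG Λ M ∧ Nontrivial M ∧
    (∀ S : Submodule Λ M, S ≠ ⊤ → ModuleCat.of Λ ↥S ∈ F) ∧
    (∀ (X F' : ModuleCat.{0} Λ) (f : F' →ₗ[Λ] X) (g : X →ₗ[Λ] M),
      Function.Injective f → Function.Surjective g →
      LinearMap.range f = LinearMap.ker g → F' ∈ F →
      (¬ ∃ s : M →ₗ[Λ] X, g ∘ₗ s = LinearMap.id) → X ∈ F) ∧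
    (∀ Y ∈ F, ∀ f : M →ₗ[Λ] Y, f = 0)

/-- The set (of representatives of isomorphism classes) of minimal extending modules. -/
def ME (T : Set (ModuleCat.{0} Λ)) : Set (ModuleCat.{0} Λ) := {M | IsMinExt Λ T M}

/-- The set (of representatives of isomorphism classes) of minimal co-extending modules. -/
def MCE (F : Set (ModuleCat.{0} Λ)) : Set (ModuleCat.{0} Λ) := {M | IsMinCoext Λ F M}

/-- `M` admits a finite filtration with subquotients isomorphic to members of `B`. -/
def FiltMem (B : Set (ModuleCat.{0} Λ)) (M : ModuleCat.{0} Λ) : Prop :=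
  ∃ (n : ℕ) (c : Fin (n + 1) → Submodule Λ M), Monotone c ∧ c 0 = ⊥ ∧ c (Fin.last n) = ⊤ ∧
    ∀ i : Fin n, ∃ N ∈ B,
      Nonempty ((↥(c i.succ) ⧸ Submodule.comap (c i.succ).subtype (c i.castSucc)) ≃ₗ[Λ] N)

/-- `Filt B`. -/
def filtClosure (B : Set (ModuleCat.{0} Λ)) : Set (ModuleCat.{0} Λ) :=
  {M | FiltMem Λ B M}

/-- The simple objects of a subcategory `C`, i.e. nonzero members with no proper nonzero
subobject belonging to `C`. -/
def simOf (C : Set (ModuleCat.{0} Λ)) : Set (ModuleCat.{0} Λ) :=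
  {M | M ∈ C ∧ Nontrivial M ∧
    ∀ (X : ModuleCat.{0} Λ) (f : X →ₗ[Λ] M), X ∈ C → Function.Injective f →
      LinearMap.range f = ⊥ ∨ LinearMap.range f = ⊤}

/-- The subcategory `α(T) = {X ∈ T : for all g : Y → X with Y ∈ T, ker g ∈ T}`. -/
def alphaOf (T : Set (ModuleCat.{0} Λ)) : Set (ModuleCat.{0} Λ) :=
  {X | X ∈ T ∧ ∀ (Y : ModuleCat.{0} Λ) (g : Y →ₗ[Λ] X), Y ∈ T →
    ModuleCat.of Λ ↥(LinearMap.ker g) ∈ T}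

/-- Covariantly finite subcategory of `mod Λ`. -/
def CovariantlyFinite (B : Set (ModuleCat.{0} Λ)) : Prop :=
  ∀ M : ModuleCat.{0} Λ, FG Λ M → ∃ N ∈ B, ∃ f : M →ₗ[Λ] N,
    ∀ N' ∈ B, ∀ g : M →ₗ[Λ] N', ∃ h : N →ₗ[Λ] N', h ∘ₗ f = g

/-- Contravariantly finite subcategory of `mod Λ`. -/
def ContravariantlyFinite (B : Set (ModuleCat.{0} Λ)) : Prop :=
  ∀ M : ModuleCat.{0} Λ, FG Λ M → ∃ N ∈ B, ∃ f : N →ₗ[Λ] M,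
    ∀ N' ∈ B, ∀ g : N' →ₗ[Λ] M, ∃ h : N' →ₗ[Λ] N, f ∘ₗ h = g

/-- Functorially finite subcategory of `mod Λ`. -/
def FunctoriallyFinite (B : Set (ModuleCat.{0} Λ)) : Prop :=
  CovariantlyFinite Λ B ∧ ContravariantlyFinite Λ B

/-- Closure under (set-indexed) coproducts. -/
def CoprodClosed (C : Set (ModuleCat.{0} Λ)) : Prop :=
  ∀ (ι : Type) (M : ι → ModuleCat.{0} Λ), (∀ i, M i ∈ C) →
    ModuleCat.of Λ (⨁ i, (M i : Type)) ∈ C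

/-- Closure under (set-indexed) products. -/
def ProdClosed (C : Set (ModuleCat.{0} Λ)) : Prop :=
  ∀ (ι : Type) (M : ι → ModuleCat.{0} Λ), (∀ i, M i ∈ C) →
    ModuleCat.of Λ ((i : ι) → (M i : Type)) ∈ C

/-! Lattice-theoretic notions in the complete lattice of torsion classes. -/

/-- The join of a set of torsion classes. -/
def torsJoin (X : Set (Set (ModuleCat.{0} Λ))) : Set (ModuleCat.{0} Λ) :=
  torsClosure Λ (⋃₀ X)

/-- The meet of a set of torsion classes (inside the lattice of torsion classes,
whose top element is `mod Λ`). -/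
def torsMeet (X : Set (Set (ModuleCat.{0} Λ))) : Set (ModuleCat.{0} Λ) :=
  {M | FG Λ M} ∩ ⋂₀ X

/-- A completely join-irreducible torsion class. -/
def CompletelyJoinIrred (J : Set (ModuleCat.{0} Λ)) : Prop :=
  IsTorsionClass Λ J ∧
    ∀ X : Set (Set (ModuleCat.{0} Λ)), (∀ a ∈ X, IsTorsionClass Λ a) →
      torsJoin Λ X = J → J ∈ X

/-- `J_* = ⋁ {x : x < J}`. -/
def jstar (J : Set (ModuleCat.{0} Λ)) : Set (ModuleCat.{0} Λ) :=
  torsJoin Λ {C | IsTorsionClass Λ C ∧ C ⊂ J}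

/-- `k = κ(J) = max {x : J ∧ x = J_*}`. -/
def IsKappa (J k : Set (ModuleCat.{0} Λ)) : Prop :=
  IsTorsionClass Λ k ∧ J ∩ k = jstar Λ J ∧
    ∀ C, IsTorsionClass Λ C → J ∩ C = jstar Λ J → C ⊆ k

/-- `A` is a join representation of the torsion class `T`. -/
def IsJoinRep (T : Set (ModuleCat.{0} Λ)) (A : Set (Set (ModuleCat.{0} Λ))) : Prop :=
  (∀ a ∈ A, IsTorsionClass Λ a) ∧ torsJoin Λ A = T

/-- `A` refines `B`. -/
def Refines (A B : Set (Set (ModuleCat.{0} Λ))) : Prop :=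
  ∀ a ∈ A, ∃ b ∈ B, a ⊆ b

/-- `A` is the canonical join representation of `T`. -/
def IsCJR (T : Set (ModuleCat.{0} Λ)) (A : Set (Set (ModuleCat.{0} Λ))) : Prop :=
  IsJoinRep Λ T A ∧ (∀ B, IsJoinRep Λ T B → Refines Λ A B) ∧
    ∀ a ∈ A, ∀ b ∈ A, a ⊆ b → a = b

/-- `Kb = κ̄(T) = ⋀ {κ(j) : j ∈ CJR(T)}`, the extended kappa map. -/
def IsKappaBar (T Kb : Set (ModuleCat.{0} Λ)) : Prop :=
  ∃ A, IsCJR Λ T A ∧ (∀ j ∈ A, CompletelyJoinIrred Λ j) ∧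
    (∀ j ∈ A, ∃ k, IsKappa Λ j k) ∧
    Kb = torsMeet Λ {k | ∃ j ∈ A, IsKappa Λ j k}

/-- The kappa order: `a ≤_κ b` iff `a ≤ b` and `κ̄(a) ≥ κ̄(b)`. -/
def KappaLE (a b : Set (ModuleCat.{0} Λ)) : Prop :=
  a ⊆ b ∧ ∀ Ka Kb, IsKappaBar Λ a Ka → IsKappaBar Λ b Kb → Kb ⊆ Ka

section Auxiliary

variable {Λ}

theorem isTorsionClass_fg : IsTorsionClass Λ {M | FG Λ M} := by
  refine ⟨fun M hM => hM, ?_, ?_, ?_, ?_⟩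
  · rintro M N ⟨e⟩ hM
    have : Module.Finite Λ M := hM
    exact Module.Finite.equiv e
  · intro M hM
    exact Module.Finite.of_finite
  · intro M N g hg hM
    have : Module.Finite Λ M := hM
    exact Module.Finite.of_surjective g hg
  · intro A M B f g _ hg hfg hA hB
    have : Module.Finite Λ A := hA
    have : Module.Finite Λ B := hB
    have : Module.Finite Λ (LinearMap.ker g) := hfg ▸ inferInstance
    have : Module.Finite Λ (M ⧸ LinearMap.ker g) :=
      Module.Finite.equiv (g.quotKerEquivOfSurjective hg).symm
    exact Module.Finite.of_submodule_quotient (LinearMap.ker g)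

theorem subset_torsClosure (X : Set (ModuleCat.{0} Λ)) : X ⊆ torsClosure Λ X :=
  fun _ hM _ hC => hC.2 hM

theorem torsClosure_subset {X C : Set (ModuleCat.{0} Λ)} (hC : IsTorsionClass Λ C)
    (hXC : X ⊆ C) : torsClosure Λ X ⊆ C :=
  fun _ hM => hM C ⟨hC, hXC⟩

theorem isTorsionClass_torsClosure {X : Set (ModuleCat.{0} Λ)} (hX : ∀ M ∈ X, FG Λ M) :
    IsTorsionClass Λ (torsClosure Λ X) := by
  refine ⟨fun M hM => hM _ ⟨isTorsionClass_fg, hX⟩, ?_, ?_, ?_, ?_⟩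
  · exact fun M N e hM C hC => hC.1.2.1 e (hM C hC)
  · exact fun M hM C hC => hC.1.2.2.1 M hM
  · exact fun M N g hg hM C hC => hC.1.2.2.2.1 g hg (hM C hC)
  · exact fun A M B f g hf hg h hA hB C hC => hC.1.2.2.2.2 f g hf hg h (hA C hC) (hB C hC)

namespace IsTorsionClass

variable {T : Set (ModuleCat.{0} Λ)}

theorem range_mem (hT : IsTorsionClass Λ T) {X M : ModuleCat.{0} Λ} (f : X →ₗ[Λ] M)
    (hX : X ∈ T) : ModuleCat.of Λ (LinearMap.range f) ∈ T :=
  hT.2.2.2.1 (N := ModuleCat.of Λ (LinearMap.range f)) f.rangeRestrict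
    f.surjective_rangeRestrict hX

/-- The torsion radical of a submodule `N` of `M`. -/
theorem exists_radical [IsNoetherianRing Λ] (hT : IsTorsionClass Λ T) {M : ModuleCat.{0} Λ}
    (hM : FG Λ M) (N : Submodule Λ M) :
    ∃ t ≤ N, ModuleCat.of Λ t ∈ T ∧ ∀ X ∈ T, ∀ f : X →ₗ[Λ] (M ⧸ t),
      (∀ x, f x ∈ N.map t.mkQ) → f = 0 := by
  have : Module.Finite Λ M := hM
  obtain ⟨t, ⟨htN, htT⟩, hmax⟩ := WellFounded.has_min
    (wellFounded_gt : WellFounded ((· > ·) : Submodule Λ M → Submodule Λ M → Prop))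
    {t | t ≤ N ∧ ModuleCat.of Λ t ∈ T} ⟨⊥, bot_le, hT.2.2.1 _
      (inferInstanceAs (Subsingleton (⊥ : Submodule Λ M)))⟩
  refine ⟨t, htN, htT, fun X hX f hf => ?_⟩
  set r := LinearMap.range f with hr
  have hrT : ModuleCat.of Λ r ∈ T := hT.range_mem (M := ModuleCat.of Λ (M ⧸ t)) f hX
  set s : Submodule Λ M := r.comap t.mkQ with hs
  have hts : t ≤ s := by
    intro x hx
    have : t.mkQ x = 0 := by simpa using hx
    simp [hs, this]
  have hsN : s ≤ N := by
    rintro x ⟨y, hy⟩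
    obtain ⟨n, hn, hny⟩ := hf y
    rw [hy] at hny
    have : n - x ∈ t := by
      rw [← Submodule.Quotient.mk_eq_zero, Submodule.Quotient.mk_sub, sub_eq_zero]
      exact hny
    have h2 := N.sub_mem hn (htN this)
    simpa using h2
  have hsT : ModuleCat.of Λ s ∈ T := by
    let q : s →ₗ[Λ] r := t.mkQ.restrict (fun x hx => hx)
    refine hT.2.2.2.2 (A := ModuleCat.of Λ t) (M := ModuleCat.of Λ s) (B := ModuleCat.of Λ r)
      (Submodule.inclusion hts) q (Submodule.inclusion_injective hts) ?_ ?_ htT hrT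
    · rintro ⟨y, hy⟩
      obtain ⟨x, rfl⟩ := t.mkQ_surjective y
      exact ⟨⟨x, hy⟩, rfl⟩
    · ext ⟨x, hx⟩
      simp [q, LinearMap.mem_ker, Subtype.ext_iff, Submodule.range_inclusion]
  have hst : s = t := by
    by_contra hne
    exact hmax s ⟨hsN, hsT⟩ (lt_of_le_of_ne hts (Ne.symm hne))
  ext x
  obtain ⟨y, hy⟩ := t.mkQ_surjective (f x)
  have hys : y ∈ s := by
    change t.mkQ y ∈ r
    rw [hy]
    exact ⟨x, rfl⟩
  rw [hst] at hys
  rw [← hy]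
  simpa using hys

theorem mem_of_forall_rPerp [IsNoetherianRing Λ] (hT : IsTorsionClass Λ T)
    {M : ModuleCat.{0} Λ} (hM : FG Λ M)
    (h : ∀ Y ∈ rPerp Λ T, ∀ f : M →ₗ[Λ] Y, f = 0) : M ∈ T := by
  have : Module.Finite Λ M := hM
  obtain ⟨t, -, htT, ht⟩ := hT.exists_radical hM ⊤
  have h0 := h (ModuleCat.of Λ (M ⧸ t))
    ⟨inferInstanceAs (Module.Finite Λ (M ⧸ t)), fun X hX f => ht X hX f fun x => by
      rw [Submodule.map_top, Submodule.range_mkQ]; trivial⟩ t.mkQ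
  have htop : t = ⊤ := by
    rw [← t.ker_mkQ]
    exact LinearMap.ker_eq_top.2 h0
  subst htop
  exact hT.2.1 ⟨Submodule.topEquiv⟩ htT

/-- A torsion submodule of a member of `alphaOf Λ T` lies in `alphaOf Λ T`. -/
theorem alphaOf_of_injective {X N : ModuleCat.{0} Λ} (hX : X ∈ alphaOf Λ T) (hN : N ∈ T)
    (i : N →ₗ[Λ] X) (hi : Injective i) : N ∈ alphaOf Λ T := by
  refine ⟨hN, fun Y g hY => ?_⟩
  have := hX.2 Y (i ∘ₗ g) hY
  rwa [LinearMap.ker_comp_of_ker_eq_bot g (LinearMap.ker_eq_bot.2 hi)] at this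

/-- The quotient of a member of `alphaOf Λ T` by a torsion submodule lies in `alphaOf Λ T`. -/
theorem alphaOf_quotient (hT : IsTorsionClass Λ T) {X : ModuleCat.{0} Λ}
    (hX : X ∈ alphaOf Λ T) (S : Submodule Λ X) (hS : ModuleCat.of Λ S ∈ T) :
    ModuleCat.of Λ (X ⧸ S) ∈ alphaOf Λ T := by
  refine ⟨hT.2.2.2.1 (N := ModuleCat.of Λ (X ⧸ S)) S.mkQ S.mkQ_surjective hX.1,
    fun Y g hY => ?_⟩
  let d : Y × X →ₗ[Λ] (X ⧸ S) :=
    LinearMap.coprod (show Y →ₗ[Λ] (X ⧸ S) from g) (-S.mkQ)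
  have hd : ∀ p : Y × X, p ∈ LinearMap.ker d ↔ g p.1 = S.mkQ p.2 := by
    intro p
    rw [LinearMap.mem_ker, LinearMap.coprod_apply, LinearMap.neg_apply, ← sub_eq_add_neg,
      sub_eq_zero]
  let P := ModuleCat.of Λ (LinearMap.ker d)
  let p₁ : P →ₗ[Λ] Y := LinearMap.fst Λ Y X ∘ₗ (LinearMap.ker d).subtype
  let p₂ : P →ₗ[Λ] X := LinearMap.snd Λ Y X ∘ₗ (LinearMap.ker d).subtype
  let j : S →ₗ[Λ] P := (LinearMap.inr Λ Y X ∘ₗ S.subtype).codRestrict (LinearMap.ker d)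
    (fun s => (hd _).2 <| by
      rw [LinearMap.comp_apply, LinearMap.inr_apply, map_zero]
      exact ((Submodule.Quotient.mk_eq_zero S).2 s.2).symm)
  have hP : P ∈ T := by
    refine hT.2.2.2.2 (A := ModuleCat.of Λ S) (M := P) (B := Y) j p₁ ?_ ?_ ?_ hS hY
    · intro a b hab
      have h1 : ((j a : LinearMap.ker d) : Y × X).2 = ((j b : LinearMap.ker d) : Y × X).2 := by
        rw [hab]
      exact Subtype.ext h1
    · intro y
      obtain ⟨x, hx⟩ := S.mkQ_surjective (g y)
      exact ⟨⟨(y, x), (hd _).2 hx.symm⟩, rfl⟩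
    · ext z
      constructor
      · rintro ⟨s, rfl⟩
        rfl
      · intro hz
        obtain ⟨⟨y, x⟩, hyx⟩ := z
        have hy : y = 0 := hz
        subst hy
        have hx : x ∈ S := by
          have h1 := (hd _).1 hyx
          rw [map_zero] at h1
          exact (Submodule.Quotient.mk_eq_zero S).1 h1.symm
        exact ⟨⟨x, hx⟩, rfl⟩
  have hK := hX.2 P p₂ hP
  refine hT.2.2.2.1 (M := ModuleCat.of Λ (LinearMap.ker p₂))
    (N := ModuleCat.of Λ (LinearMap.ker g))
    ((p₁ ∘ₗ (LinearMap.ker p₂).subtype).codRestrict (LinearMap.ker g) ?_) ?_ hK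
  · rintro ⟨⟨⟨y, x⟩, hyx⟩, hz⟩
    have hx : x = 0 := hz
    subst hx
    have h1 := (hd _).1 hyx
    rw [map_zero] at h1
    exact h1
  · rintro ⟨y, hy⟩
    refine ⟨⟨⟨(y, 0), (hd _).2 ?_⟩, rfl⟩, rfl⟩
    rw [map_zero]
    exact hy

theorem isWide_alphaOf (hT : IsTorsionClass Λ T) : IsWide Λ (alphaOf Λ T) := by
  refine ⟨fun M hM => hT.1 M hM.1, ?_, ?_, ?_, ?_, ?_⟩
  · rintro M N ⟨e⟩ hM
    exact alphaOf_of_injective hM (hT.2.1 ⟨e⟩ hM.1) e.symm.toLinearMap e.symm.injective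
  · intro M hM
    refine ⟨hT.2.2.1 M hM, fun Y g hY => ?_⟩
    have hg : g = 0 := LinearMap.ext fun y => Subsingleton.elim _ _
    rw [hg, LinearMap.ker_zero]
    exact hT.2.1 ⟨Submodule.topEquiv.symm⟩ hY
  · intro M N f hM hN
    exact alphaOf_of_injective hM (hN.2 M f hM.1) (LinearMap.ker f).subtype
      (LinearMap.ker f).injective_subtype
  · intro M N f hM hN
    exact hT.alphaOf_quotient hN _ (hT.range_mem f hM.1)
  · intro A M B f g hf hg hfg hA hB
    refine ⟨hT.2.2.2.2 f g hf hg hfg hA.1 hB.1, fun Y h hY => ?_⟩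
    have hK := hB.2 Y (g ∘ₗ h) hY
    let e := LinearEquiv.ofInjective f hf
    let u : LinearMap.ker (g ∘ₗ h) →ₗ[Λ] A := e.symm.toLinearMap ∘ₗ
      (h ∘ₗ (LinearMap.ker (g ∘ₗ h)).subtype).codRestrict (LinearMap.range f)
        (fun y => by rw [hfg]; exact y.2)
    have hfu : ∀ y, f (u y) = h y := fun y =>
      congrArg Subtype.val (e.apply_symm_apply _)
    refine hT.2.2.2.1 (M := ModuleCat.of Λ (LinearMap.ker u))
      (((LinearMap.ker (g ∘ₗ h)).subtype ∘ₗ (LinearMap.ker u).subtype).codRestrict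
        (LinearMap.ker h) ?_) ?_ (hA.2 (ModuleCat.of Λ (LinearMap.ker (g ∘ₗ h))) u hK)
    · rintro ⟨y, hy⟩
      have h1 := hfu y
      rw [LinearMap.mem_ker.1 hy, map_zero] at h1
      exact h1.symm
    · rintro ⟨y, hy⟩
      have hy0 : h y = 0 := hy
      refine ⟨⟨⟨y, ?_⟩, ?_⟩, rfl⟩
      · simp [LinearMap.mem_ker, hy0]
      · refine hf ?_
        exact (hfu _).trans (hy0.trans (map_zero f).symm)

theorem MCE_subset_alphaOf [IsNoetherianRing Λ] (hT : IsTorsionClass Λ T) :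
    MCE Λ (rPerp Λ T) ⊆ alphaOf Λ T := by
  rintro M ⟨hM, hMn, hsub, hext, hperp⟩
  refine ⟨hT.mem_of_forall_rPerp hM hperp, fun Y g hY => ?_⟩
  by_cases hg : LinearMap.range g = ⊤
  · have hYf : Module.Finite Λ Y := hT.1 Y hY
    obtain ⟨t, htk, htT, ht⟩ := hT.exists_radical (hT.1 Y hY) (LinearMap.ker g)
    let gb : (Y ⧸ t) →ₗ[Λ] M := t.liftQ g htk
    have hgb : ∀ y, gb (t.mkQ y) = g y := fun y => rfl
    have hker : ∀ x, gb x = 0 → x ∈ (LinearMap.ker g).map t.mkQ := by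
      intro x hx
      obtain ⟨y, rfl⟩ := t.mkQ_surjective x
      exact ⟨y, hx, rfl⟩
    have hgs : Surjective g := LinearMap.range_eq_top.1 hg
    by_cases hs : ∃ s : M →ₗ[Λ] (Y ⧸ t), gb ∘ₗ s = LinearMap.id
    · obtain ⟨s, hs⟩ := hs
      have h0 := ht Y hY ((LinearMap.id - s ∘ₗ gb) ∘ₗ t.mkQ) (fun y => hker _ (by
        have h1 := LinearMap.congr_fun hs (gb (t.mkQ y))
        simp only [LinearMap.comp_apply, LinearMap.id_apply] at h1
        simp only [LinearMap.comp_apply, LinearMap.sub_apply, LinearMap.id_apply, map_sub, h1,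
          sub_self]))
      have hkt : LinearMap.ker g = t := by
        refine le_antisymm (fun y hy => ?_) htk
        have h1 := LinearMap.congr_fun h0 y
        simp only [LinearMap.comp_apply, LinearMap.sub_apply, LinearMap.id_apply, hgb,
          LinearMap.mem_ker.1 hy, map_zero, sub_zero, LinearMap.zero_apply] at h1
        exact (Submodule.Quotient.mk_eq_zero t).1 h1
      rwa [hkt]
    · exfalso
      have hX := hext (ModuleCat.of Λ (Y ⧸ t)) (ModuleCat.of Λ (LinearMap.ker gb))
        (LinearMap.ker gb).subtype gb (LinearMap.ker gb).injective_subtype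
        (fun m => by obtain ⟨y, rfl⟩ := hgs m; exact ⟨t.mkQ y, rfl⟩)
        (LinearMap.ker gb).range_subtype
        ⟨inferInstanceAs (Module.Finite Λ (LinearMap.ker gb)), fun Z hZ f => by
          have h0 := ht Z hZ ((LinearMap.ker gb).subtype ∘ₗ f) (fun z => hker _ (f z).2)
          exact LinearMap.ext fun z => Subtype.ext (LinearMap.congr_fun h0 z)⟩ hs
      have h0 : t.mkQ = 0 := hX.2 Y hY t.mkQ
      obtain ⟨m, hm⟩ := exists_ne (0 : M)
      obtain ⟨y, rfl⟩ := hgs m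
      refine hm ?_
      rw [← hgb, h0, LinearMap.zero_apply, map_zero]
  · have h0 := (hsub _ hg).2 Y hY g.rangeRestrict
    have hg0 : LinearMap.ker g = ⊤ := by
      rw [← LinearMap.ker_rangeRestrict]
      exact LinearMap.ker_eq_top.2 h0
    rw [hg0]
    exact hT.2.1 ⟨Submodule.topEquiv.symm⟩ hY

/-- A nonzero member of `alphaOf Λ T` without proper nonzero torsion submodules is minimal
co-extending for `rPerp Λ T`. -/
theorem isMinCoext_of_simple [IsNoetherianRing Λ] (hT : IsTorsionClass Λ T)
    {S : ModuleCat.{0} Λ} (hS : S ∈ alphaOf Λ T) (hn : Nontrivial S)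
    (hsimple : ∀ N : Submodule Λ S, ModuleCat.of Λ N ∈ T → N = ⊥ ∨ N = ⊤) :
    IsMinCoext Λ (rPerp Λ T) S := by
  have hSf : Module.Finite Λ S := hT.1 S hS.1
  refine ⟨hSf, hn, fun N hN => ⟨inferInstanceAs (Module.Finite Λ N), fun X hX f => ?_⟩, ?_,
    fun Y hY f => hY.2 S hS.1 f⟩
  · rcases hsimple _ (hT.range_mem (N.subtype ∘ₗ f) hX) with h | h
    · rw [LinearMap.range_eq_bot] at h
      exact LinearMap.ext fun z => Subtype.ext (LinearMap.congr_fun h z)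
    · refine absurd (top_le_iff.1 ?_) hN
      rw [← h]
      rintro _ ⟨x, rfl⟩
      exact (f x).2
  · intro X F' f g hf hg hfg hF' hns
    have hzero : ∀ Z ∈ T, ∀ u : Z →ₗ[Λ] X, g ∘ₗ u = 0 → u = 0 := by
      intro Z hZ u hu
      let e := LinearEquiv.ofInjective f hf
      have h0 := hF'.2 Z hZ (e.symm.toLinearMap ∘ₗ u.codRestrict (LinearMap.range f)
        (fun y => by rw [hfg]; exact LinearMap.congr_fun hu y))
      ext z
      have h1 := LinearMap.congr_fun h0 z
      have h2 := e.symm.map_eq_zero_iff.1 h1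
      exact congrArg Subtype.val h2
    refine ⟨isTorsionClass_fg.2.2.2.2 f g hf hg hfg hF'.1 hSf, fun Y hY h => ?_⟩
    rcases hsimple _ (hT.range_mem (g ∘ₗ h) hY) with h1 | h1
    · exact hzero Y hY h (LinearMap.range_eq_bot.1 h1)
    · exfalso
      have hsurj : Surjective (g ∘ₗ h) := LinearMap.range_eq_top.1 h1
      have h2 := hzero _ (hS.2 Y (g ∘ₗ h) hY) (h ∘ₗ (LinearMap.ker (g ∘ₗ h)).subtype)
        (LinearMap.ext fun y => y.2)
      let s : S →ₗ[Λ] X := (LinearMap.ker (g ∘ₗ h)).liftQ h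
        (fun y hy => LinearMap.congr_fun h2 ⟨y, hy⟩) ∘ₗ
          ((g ∘ₗ h).quotKerEquivOfSurjective hsurj).symm.toLinearMap
      refine hns ⟨s, LinearMap.ext fun m => ?_⟩
      obtain ⟨y, rfl⟩ := hsurj m
      have h3 : ((g ∘ₗ h).quotKerEquivOfSurjective hsurj).symm ((g ∘ₗ h) y) =
          (LinearMap.ker (g ∘ₗ h)).mkQ y := by
        rw [LinearEquiv.symm_apply_eq]
        rfl
      simp only [s, LinearMap.comp_apply g, LinearMap.comp_apply, LinearEquiv.coe_coe] at h3 ⊢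
      rw [h3]
      rfl

theorem exists_simple [IsNoetherianRing Λ] [IsArtinianRing Λ] (hT : IsTorsionClass Λ T)
    {X : ModuleCat.{0} Λ} (hX : X ∈ alphaOf Λ T) (hn : Nontrivial X) :
    ∃ S : Submodule Λ X, S ≠ ⊥ ∧ ModuleCat.of Λ S ∈ MCE Λ (rPerp Λ T) := by
  have : Module.Finite Λ X := hT.1 X hX.1
  obtain ⟨S, ⟨hS0, hST⟩, hmin⟩ := WellFounded.has_min
    (wellFounded_lt : WellFounded ((· < ·) : Submodule Λ X → Submodule Λ X → Prop))
    {S | S ≠ ⊥ ∧ ModuleCat.of Λ S ∈ T} ⟨⊤, top_ne_bot, hT.2.1 ⟨Submodule.topEquiv.symm⟩ hX.1⟩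
  refine ⟨S, hS0, hT.isMinCoext_of_simple
    (alphaOf_of_injective hX hST S.subtype S.injective_subtype)
    (Submodule.nontrivial_iff_ne_bot.2 hS0) fun N hN => ?_⟩
  change Submodule Λ S at N
  by_contra! hcon
  have hle := Submodule.map_subtype_le S N
  refine hmin (N.map S.subtype) ⟨fun h => hcon.1 ?_, ?_⟩ (lt_of_le_of_ne hle fun h => hcon.2 ?_)
  · exact Submodule.map_injective_of_injective S.injective_subtype (by rw [h, Submodule.map_bot])
  · exact hT.2.1 ⟨Submodule.equivMapOfInjective S.subtype S.injective_subtype N⟩ hN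
  · refine Submodule.map_injective_of_injective S.injective_subtype ?_
    rw [h, Submodule.map_subtype_top]

theorem alphaOf_subset [IsNoetherianRing Λ] [IsArtinianRing Λ] (hT : IsTorsionClass Λ T) :
    alphaOf Λ T ⊆ torsClosure Λ (MCE Λ (rPerp Λ T)) := by
  intro X hX
  have hT' : IsTorsionClass Λ (torsClosure Λ (MCE Λ (rPerp Λ T))) :=
    isTorsionClass_torsClosure fun M hM => hM.1
  have hle : torsClosure Λ (MCE Λ (rPerp Λ T)) ⊆ T :=
    torsClosure_subset hT fun M hM => (hT.MCE_subset_alphaOf hM).1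
  obtain ⟨t, -, htT, ht⟩ := hT'.exists_radical (hT.1 X hX.1) ⊤
  have htop : t = ⊤ := by
    by_contra hne
    obtain ⟨S, hS0, hS⟩ := hT.exists_simple (hT.alphaOf_quotient hX t (hle htT))
      (Submodule.Quotient.nontrivial_iff.2 hne)
    refine hS0 ?_
    have h0 := ht _ (subset_torsClosure _ hS) S.subtype fun x => by
      rw [Submodule.map_top, Submodule.range_mkQ]; trivial
    rw [← S.range_subtype, LinearMap.range_eq_bot]
    exact h0
  subst htop
  exact hT'.2.1 ⟨Submodule.topEquiv⟩ htT

end IsTorsionClass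

theorem IsWide.range_mem {W : Set (ModuleCat.{0} Λ)} (hW : IsWide Λ W) {M N : ModuleCat.{0} Λ}
    (f : M →ₗ[Λ] N) (hM : M ∈ W) (hN : N ∈ W) : ModuleCat.of Λ (LinearMap.range f) ∈ W := by
  have h := hW.2.2.2.1 (N := ModuleCat.of Λ (N ⧸ LinearMap.range f)) (LinearMap.range f).mkQ hN
    (hW.2.2.2.2.1 f hM hN)
  rwa [Submodule.ker_mkQ] at h

/-- A wide subcategory is contained in `alphaOf` of the torsion class it generates. -/
theorem IsWide.subset_alphaOf_torsClosure {W : Set (ModuleCat.{0} Λ)} (hW : IsWide Λ W) :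
    W ⊆ alphaOf Λ (torsClosure Λ W) := by
  have hT : IsTorsionClass Λ (torsClosure Λ W) := isTorsionClass_torsClosure hW.1
  let C : Set (ModuleCat.{0} Λ) := {Y | Y ∈ torsClosure Λ W ∧ ∀ X ∈ W, ∀ g : Y →ₗ[Λ] X,
    ModuleCat.of Λ (LinearMap.range g) ∈ W ∧
      ModuleCat.of Λ (LinearMap.ker g) ∈ torsClosure Λ W}
  have hWC : W ⊆ C := fun Y hY => ⟨subset_torsClosure W hY, fun X hX g =>
    ⟨hW.range_mem g hY hX, subset_torsClosure W (hW.2.2.2.1 g hY hX)⟩⟩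
  have hquot : QuotClosed Λ C := by
    intro M N q hq hM
    refine ⟨hT.2.2.2.1 q hq hM.1, fun X hX g => ?_⟩
    obtain ⟨h1, h2⟩ := hM.2 X hX (g ∘ₗ q)
    rw [LinearMap.range_comp_of_range_eq_top g (LinearMap.range_eq_top.2 hq)] at h1
    refine ⟨h1, hT.2.2.2.1 (M := ModuleCat.of Λ (LinearMap.ker (g ∘ₗ q)))
      (N := ModuleCat.of Λ (LinearMap.ker g))
      (q.restrict (p := LinearMap.ker (g ∘ₗ q)) (q := LinearMap.ker g) fun x hx => hx) ?_ h2⟩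
    rintro ⟨y, hy⟩
    obtain ⟨x, rfl⟩ := hq y
    exact ⟨⟨x, hy⟩, rfl⟩
  have hext : ExtClosed Λ C := by
    intro A M B f q hf hq hfq hA hB
    refine ⟨hT.2.2.2.2 f q hf hq hfq hA.1 hB.1, fun X hX g => ?_⟩
    obtain ⟨hIW, hKA⟩ := hA.2 X hX (g ∘ₗ f)
    set I := LinearMap.range (g ∘ₗ f) with hI
    have hXI : ModuleCat.of Λ (X ⧸ I) ∈ W :=
      hW.2.2.2.2.1 (M := ModuleCat.of Λ I) (N := X) I.subtype hIW hX |> fun h => by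
        rwa [Submodule.range_subtype] at h
    have hfI : ∀ m, m ∈ LinearMap.ker q → g m ∈ I := by
      intro m hm
      rw [← hfq] at hm
      obtain ⟨a, rfl⟩ := hm
      exact ⟨a, rfl⟩
    let gb : B →ₗ[Λ] (X ⧸ I) := (LinearMap.ker q).liftQ (I.mkQ ∘ₗ g)
      (fun m hm => (Submodule.Quotient.mk_eq_zero I).2 (hfI m hm)) ∘ₗ
        (q.quotKerEquivOfSurjective hq).symm.toLinearMap
    have hgb : ∀ m, gb (q m) = I.mkQ (g m) := by
      intro m
      have h3 : (q.quotKerEquivOfSurjective hq).symm (q m) = (LinearMap.ker q).mkQ m := by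
        rw [LinearEquiv.symm_apply_eq]
        rfl
      simp only [gb, LinearMap.comp_apply, LinearEquiv.coe_coe, h3]
      rfl
    obtain ⟨hRB, hKB⟩ := hB.2 _ hXI gb
    have hIle : I ≤ LinearMap.range g := LinearMap.range_comp_le_range f g
    constructor
    · refine hW.2.2.2.2.2 (A := ModuleCat.of Λ I) (M := ModuleCat.of Λ (LinearMap.range g))
        (B := ModuleCat.of Λ (LinearMap.range gb)) (Submodule.inclusion hIle)
        (I.mkQ.restrict (p := LinearMap.range g) (q := LinearMap.range gb) ?_)
        (Submodule.inclusion_injective hIle) ?_ ?_ hIW hRB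
      · rintro _ ⟨m, rfl⟩
        exact ⟨q m, hgb m⟩
      · rintro ⟨_, b, rfl⟩
        obtain ⟨m, rfl⟩ := hq b
        exact ⟨⟨g m, m, rfl⟩, Subtype.ext (hgb m).symm⟩
      · ext ⟨x, hx⟩
        simp [LinearMap.mem_ker, Subtype.ext_iff, Submodule.range_inclusion]
    · refine hT.2.2.2.2 (A := ModuleCat.of Λ (LinearMap.ker (g ∘ₗ f)))
        (M := ModuleCat.of Λ (LinearMap.ker g)) (B := ModuleCat.of Λ (LinearMap.ker gb))
        (f.restrict (p := LinearMap.ker (g ∘ₗ f)) (q := LinearMap.ker g) fun x hx => hx)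
        (q.restrict (p := LinearMap.ker g) (q := LinearMap.ker gb) ?_) ?_ ?_ ?_ hKA hKB
      · intro m hm
        rw [LinearMap.mem_ker, hgb, LinearMap.mem_ker.1 hm, map_zero]
      · intro a b hab
        exact Subtype.ext (hf (congrArg Subtype.val hab))
      · rintro ⟨b, hb⟩
        obtain ⟨m, rfl⟩ := hq b
        rw [LinearMap.mem_ker, hgb] at hb
        obtain ⟨a, ha⟩ := (Submodule.Quotient.mk_eq_zero I).1 hb
        have hqf : q (f a) = 0 := by
          rw [← LinearMap.mem_ker, ← hfq]
          exact ⟨a, rfl⟩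
        refine ⟨⟨m - f a, ?_⟩, Subtype.ext ?_⟩
        · rw [LinearMap.mem_ker, map_sub, sub_eq_zero]
          exact ha.symm
        · change q (m - f a) = q m
          rw [map_sub, hqf, sub_zero]
      · ext ⟨m, hm⟩
        constructor
        · rintro ⟨a, ha⟩
          have hfa : f a.1 = m := congrArg Subtype.val ha
          refine Subtype.ext ?_
          change q m = 0
          rw [← LinearMap.mem_ker, ← hfq]
          exact ⟨a.1, hfa⟩
        · intro h
          have hqm : m ∈ LinearMap.ker q := congrArg Subtype.val h
          rw [← hfq] at hqm
          obtain ⟨a, rfl⟩ := hqm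
          exact ⟨⟨a, hm⟩, rfl⟩
  have hC : IsTorsionClass Λ C := by
    refine ⟨fun M hM => hT.1 M hM.1, ?_, fun M hM => hWC (hW.2.2.1 M hM), hquot, hext⟩
    rintro M N ⟨e⟩ hM
    exact hquot e.toLinearMap e.surjective hM
  exact fun X hX => ⟨subset_torsClosure W hX, fun Y g hY =>
    ((torsClosure_subset hC hWC hY).2 X hX g).2⟩

end Auxiliary

/-- A torsion class `T` in `mod Λ` is widely generated iff
`T = T(MCE(T^⊥))`. -/
theorem widelyGenerated_iff_eq_torsClosure_MCE
    (K Λ : Type) [Field K] [Ring Λ] [Algebra K Λ] [FiniteDimensional K Λ]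
    (T : Set (ModuleCat.{0} Λ)) (hT : IsTorsionClass Λ T) :
    (∃ W, IsWide Λ W ∧ T = torsClosure Λ W) ↔
      T = torsClosure Λ (MCE Λ (rPerp Λ T)) := by
  have : IsNoetherianRing Λ := IsNoetherianRing.of_finite K Λ
  have : IsArtinianRing Λ := IsArtinianRing.of_finite K Λ
  constructor
  · rintro ⟨W, hW, hTW⟩
    refine Set.Subset.antisymm ?_
      (torsClosure_subset hT fun M hM => (hT.MCE_subset_alphaOf hM).1)
    have hWα : W ⊆ alphaOf Λ T := by
      rw [hTW]
      exact hW.subset_alphaOf_torsClosure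
    intro M hM
    rw [hTW] at hM
    exact torsClosure_subset (isTorsionClass_torsClosure fun M hM => hM.1)
      (hWα.trans hT.alphaOf_subset) hM
  · intro h
    refine ⟨alphaOf Λ T, hT.isWide_alphaOf, Set.Subset.antisymm ?_
      (torsClosure_subset hT fun M hM => hM.1)⟩
    intro M hM
    rw [h] at hM
    exact torsClosure_subset (isTorsionClass_torsClosure fun M hM => hT.1 M hM.1)
      (hT.MCE_subset_alphaOf.trans (subset_torsClosure _)) hM

end BrickPaper
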